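/- arXiv:1108.4115 — 4 statements merged into one kernel-verified Lean document; each statement's English description precedes it below -/
import Mathlib

section
/- Let d : Fin n → ℕ and for each i let f_i : ℤ → ℝ be strictly decreasing on arguments ≤ d_i and strictly increasing on arguments ≥ d_i (i.e., convex with a strict minimum at d_i), and set Y_i(x) = −f_i(η_i(x)). Then a graph x on n nodes is pairwise stable for Y_1,…,Y_n if and only if: (1) for all i, Σ_{j≠i} x_ij ≤ d_i; (2) for all i ≠ j, if x_ij = 1 then Σ_{l≠i} x_il ≤ d_i and Σ_{l≠j} x_lj ≤ d_j; and (3) for all i ≠ j, if Σ_{l≠i} x_il < d_i and Σ_{l≠j} x_lj < d_j, then x_ij = 1. -/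
/-- A graph on `n` nodes: a 0/1 adjacency matrix, symmetric with zero diagonal. -/
def IsGraph {n : ℕ} (x : Fin n → Fin n → ℕ) : Prop :=
  (∀ i j, x i j = 0 ∨ x i j = 1) ∧ (∀ i j, x i j = x j i) ∧ (∀ i, x i i = 0)

/-- The degree of node `i` in the graph `x`. -/
def deg {n : ℕ} (x : Fin n → Fin n → ℕ) (i : Fin n) : ℕ := ∑ j, x i j

/-- The graph `x` with the link `ij` added. -/
def addLink {n : ℕ} (x : Fin n → Fin n → ℕ) (i j : Fin n) : Fin n → Fin n → ℕ :=
  fun a b => if (a = i ∧ b = j) ∨ (a = j ∧ b = i) then 1 else x a b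

/-- The graph `x` with the link `ij` removed. -/
def removeLink {n : ℕ} (x : Fin n → Fin n → ℕ) (i j : Fin n) : Fin n → Fin n → ℕ :=
  fun a b => if (a = i ∧ b = j) ∨ (a = j ∧ b = i) then 0 else x a b

/-- Pairwise stability (Jackson–Wolinsky) for payoff functions `Y`. -/
def PairwiseStable {n : ℕ} (Y : Fin n → (Fin n → Fin n → ℕ) → ℝ)
    (x : Fin n → Fin n → ℕ) : Prop :=
  (∀ i j, i ≠ j → x i j = 1 → Y i (removeLink x i j) ≤ Y i x) ∧
  (∀ i j, i ≠ j → x i j = 0 → Y i x < Y i (addLink x i j) → Y j (addLink x i j) < Y j x)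

theorem deg_update {n : ℕ} (x y : Fin n → Fin n → ℕ) (i j : Fin n)
    (h : ∀ b, b ≠ j → y i b = x i b) : deg y i + x i j = deg x i + y i j := by
  unfold deg
  rw [← Finset.add_sum_erase _ (fun b => y i b) (Finset.mem_univ j),
    ← Finset.add_sum_erase _ (fun b => x i b) (Finset.mem_univ j)]
  have : ∑ b ∈ Finset.univ.erase j, y i b = ∑ b ∈ Finset.univ.erase j, x i b :=
    Finset.sum_congr rfl (fun b hb => h b (Finset.ne_of_mem_erase hb))
  simp only [this]
  omega

theorem deg_addLink_left {n : ℕ} (x : Fin n → Fin n → ℕ) (i j : Fin n) (hij : i ≠ j)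
    (h0 : x i j = 0) : deg (addLink x i j) i = deg x i + 1 := by
  have := deg_update x (addLink x i j) i j (by intro b hb; simp [addLink, hb, hij])
  simpa [addLink, h0] using this

theorem deg_addLink_right {n : ℕ} (x : Fin n → Fin n → ℕ) (i j : Fin n) (hij : i ≠ j)
    (h0 : x j i = 0) : deg (addLink x i j) j = deg x j + 1 := by
  have := deg_update x (addLink x i j) j i (by intro b hb; simp [addLink, hb, hij.symm])
  simpa [addLink, h0] using this

theorem deg_removeLink_left {n : ℕ} (x : Fin n → Fin n → ℕ) (i j : Fin n) (hij : i ≠ j)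
    (h1 : x i j = 1) : deg (removeLink x i j) i + 1 = deg x i := by
  have := deg_update x (removeLink x i j) i j (by intro b hb; simp [removeLink, hb, hij])
  simpa [removeLink, h1] using this

theorem stmt5 {n : ℕ} (d : Fin n → ℕ) (f : Fin n → ℤ → ℝ)
    (hdec : ∀ i, ∀ a b : ℤ, a < b → b ≤ (d i : ℤ) → f i b < f i a)
    (hinc : ∀ i, ∀ a b : ℤ, (d i : ℤ) ≤ a → a < b → f i a < f i b)
    (Y : Fin n → (Fin n → Fin n → ℕ) → ℝ)
    (hY : ∀ i x, Y i x = -f i ((deg x i : ℤ)))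
    (x : Fin n → Fin n → ℕ) (hx : IsGraph x) :
    PairwiseStable Y x ↔
      ((∀ i, ∑ j ∈ Finset.univ.erase i, x i j ≤ d i) ∧
       (∀ i j, i ≠ j → x i j = 1 →
         ∑ l ∈ Finset.univ.erase i, x i l ≤ d i ∧
         ∑ l ∈ Finset.univ.erase j, x l j ≤ d j) ∧
       (∀ i j, i ≠ j → ∑ l ∈ Finset.univ.erase i, x i l < d i →
         ∑ l ∈ Finset.univ.erase j, x l j < d j → x i j = 1)) := by
  obtain ⟨h01, hsymm, hdiag⟩ := hx
  have e1 : ∀ i, ∑ l ∈ Finset.univ.erase i, x i l = deg x i := by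
    intro i
    unfold deg
    rw [← Finset.add_sum_erase _ (fun b => x i b) (Finset.mem_univ i)]
    simp [hdiag]
  have e2 : ∀ j, ∑ l ∈ Finset.univ.erase j, x l j = deg x j := by
    intro j
    rw [← e1 j]
    exact Finset.sum_congr rfl (fun b _ => hsymm b j)
  simp only [e1, e2]
  constructor
  · rintro ⟨hr, ha⟩
    have hle : ∀ i, deg x i ≤ d i := by
      intro i
      by_contra hlt
      push Not at hlt
      have hpos : ∑ j, x i j ≠ 0 := by
        have : deg x i ≠ 0 := by omega
        exact this
      obtain ⟨j, -, hj⟩ := Finset.exists_ne_zero_of_sum_ne_zero hpos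
      have hj1 : x i j = 1 := (h01 i j).resolve_left hj
      have hij : i ≠ j := by
        rintro rfl
        exact hj (hdiag i)
      have h := hr i j hij hj1
      have hd := deg_removeLink_left x i j hij hj1
      rw [hY, hY] at h
      have := hinc i (deg (removeLink x i j) i) (deg x i) (by omega) (by omega)
      linarith
    refine ⟨hle, fun i j _ _ => ⟨hle i, hle j⟩, ?_⟩
    intro i j hij hi hj
    by_contra hne
    have h0 : x i j = 0 := (h01 i j).resolve_right hne
    have h := ha i j hij h0
    have hdi := deg_addLink_left x i j hij h0
    have hdj := deg_addLink_right x i j hij (by rw [← hsymm, h0])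
    simp only [hY] at h
    have h1 := hdec i (deg x i) (deg (addLink x i j) i) (by omega) (by omega)
    have h2 := hdec j (deg x j) (deg (addLink x i j) j) (by omega) (by omega)
    have := h (by linarith)
    linarith
  · rintro ⟨hle, -, h3⟩
    refine ⟨?_, ?_⟩
    · intro i j hij hj1
      have hd := deg_removeLink_left x i j hij hj1
      have hl := hle i
      have := hdec i (deg (removeLink x i j) i) (deg x i) (by omega) (by omega)
      rw [hY, hY]
      linarith
    · intro i j hij h0 h
      have hdi := deg_addLink_left x i j hij h0
      have hdj := deg_addLink_right x i j hij (by rw [← hsymm, h0])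
      simp only [hY] at h ⊢
      have hi : deg x i < d i := by
        by_contra hn
        have := hinc i (deg x i) (deg (addLink x i j) i) (by omega) (by omega)
        linarith
      have hj : ¬ deg x j < d j := by
        intro hj
        have := h3 i j hij hi hj
        omega
      have := hinc j (deg x j) (deg (addLink x i j) j) (by omega) (by omega)
      linarith
end

section
/- Let d : Fin n → ℕ and for each i let f_i : ℤ → ℝ be strictly decreasing on arguments ≤ d_i and strictly increasing on arguments ≥ d_i (i.e., convex with a strict minimum at d_i), and set Y_i(x) = −f_i(η_i(x)). If the graph x on n nodes is pairwise stable for Y_1,…,Y_n, then every node's degree is at most its desired degree: η_i(x) ≤ d_i for all i. -/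
theorem stmt6 {n : ℕ} (d : Fin n → ℕ) (f : Fin n → ℤ → ℝ)
    (hdec : ∀ i, ∀ a b : ℤ, a < b → b ≤ (d i : ℤ) → f i b < f i a)
    (hinc : ∀ i, ∀ a b : ℤ, (d i : ℤ) ≤ a → a < b → f i a < f i b)
    (Y : Fin n → (Fin n → Fin n → ℕ) → ℝ)
    (hY : ∀ i x, Y i x = -f i ((deg x i : ℤ)))
    (x : Fin n → Fin n → ℕ) (hx : IsGraph x)
    (hstable : PairwiseStable Y x) :
    ∀ i, deg x i ≤ d i := by
  intro i
  by_contra hlt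
  have hlt : d i < deg x i := by omega
  obtain ⟨h01, -, hdiag⟩ := hx
  have hne : ∑ j, x i j ≠ 0 := by
    have h : deg x i ≠ 0 := by omega
    exact h
  obtain ⟨j, -, hj⟩ := Finset.exists_ne_zero_of_sum_ne_zero hne
  have hj1 : x i j = 1 := (h01 i j).resolve_left hj
  have hij : i ≠ j := by
    rintro rfl
    exact hj (hdiag i)
  have hdeg : deg x i = deg (removeLink x i j) i + 1 := by
    unfold deg
    rw [← Finset.add_sum_erase _ _ (Finset.mem_univ j),
      ← Finset.add_sum_erase _ (removeLink x i j i) (Finset.mem_univ j)]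
    have h0 : removeLink x i j i j = 0 := by simp [removeLink]
    have hs : ∑ k ∈ Finset.univ.erase j, removeLink x i j i k
        = ∑ k ∈ Finset.univ.erase j, x i k := by
      refine Finset.sum_congr rfl fun k hk => ?_
      have hk' : k ≠ j := Finset.ne_of_mem_erase hk
      simp [removeLink, hk', hij]
    rw [h0, hs, hj1]
    omega
  have h1 := hstable.1 i j hij hj1
  rw [hY, hY] at h1
  have h2 := hinc i (deg (removeLink x i j) i : ℤ) (deg x i : ℤ) (by omega) (by omega)
  linarith
end

section
/- Let d : Fin n → ℕ. A graph x on n nodes satisfies the stability conditions (for all i, Σ_{j≠i} x_ij ≤ d_i; for all i ≠ j, if x_ij = 1 then Σ_{l≠i} x_il ≤ d_i and Σ_{l≠j} x_lj ≤ d_j; and for all i ≠ j, if Σ_{l≠i} x_il < d_i and Σ_{l≠j} x_lj < d_j then x_ij = 1) if and only if there exist integers u_i ≥ 0 and z_i ∈ {0,1} for each i such that: Σ_{j≠i} x_ij + u_i = d_i for all i; z_i + z_j − 1 ≤ x_ij for all i ≠ j; z_i ≤ u_i for all i; and u_i ≤ d_i · z_i for all i. -/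
theorem stmt7 {n : ℕ} (d : Fin n → ℕ) (x : Fin n → Fin n → ℕ) (hx : IsGraph x) :
    ((∀ i, ∑ j ∈ Finset.univ.erase i, x i j ≤ d i) ∧
     (∀ i j, i ≠ j → x i j = 1 →
       ∑ l ∈ Finset.univ.erase i, x i l ≤ d i ∧
       ∑ l ∈ Finset.univ.erase j, x l j ≤ d j) ∧
     (∀ i j, i ≠ j → ∑ l ∈ Finset.univ.erase i, x i l < d i →
       ∑ l ∈ Finset.univ.erase j, x l j < d j → x i j = 1)) ↔
    (∃ (u z : Fin n → ℤ),
      (∀ i, 0 ≤ u i) ∧ (∀ i, z i = 0 ∨ z i = 1) ∧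
      (∀ i, (∑ j ∈ Finset.univ.erase i, (x i j : ℤ)) + u i = (d i : ℤ)) ∧
      (∀ i j, i ≠ j → z i + z j - 1 ≤ (x i j : ℤ)) ∧
      (∀ i, z i ≤ u i) ∧ (∀ i, u i ≤ (d i : ℤ) * z i)) := by
  obtain ⟨h01, hsym, -⟩ := hx
  have hS : ∀ j, ∑ l ∈ Finset.univ.erase j, x l j = ∑ l ∈ Finset.univ.erase j, x j l :=
    fun j => Finset.sum_congr rfl fun l _ => hsym l j
  simp only [hS, ← Nat.cast_sum]
  have key : ∀ S : Fin n → ℕ,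
    ((∀ i, S i ≤ d i) ∧ (∀ i j, i ≠ j → x i j = 1 → S i ≤ d i ∧ S j ≤ d j) ∧
     (∀ i j, i ≠ j → S i < d i → S j < d j → x i j = 1)) ↔
    (∃ (u z : Fin n → ℤ),
      (∀ i, 0 ≤ u i) ∧ (∀ i, z i = 0 ∨ z i = 1) ∧
      (∀ i, (S i : ℤ) + u i = (d i : ℤ)) ∧
      (∀ i j, i ≠ j → z i + z j - 1 ≤ (x i j : ℤ)) ∧
      (∀ i, z i ≤ u i) ∧ (∀ i, u i ≤ (d i : ℤ) * z i)) := by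
    intro S
    constructor
    · rintro ⟨h1, -, h3⟩
      refine ⟨fun i => (d i : ℤ) - S i, fun i => if S i < d i then 1 else 0, ?_, ?_, ?_, ?_, ?_, ?_⟩
      · intro i
        have := h1 i
        dsimp only
        omega
      · intro i
        dsimp only
        split_ifs <;> simp
      · intro i
        dsimp only
        omega
      · intro i j hij
        have := h3 i j hij
        dsimp only
        split_ifs with ha hb hb
        · have := this ha hb
          omega
        all_goals omega
      · intro i
        have := h1 i
        dsimp only
        split_ifs <;> omega
      · intro i
        have := h1 i
        dsimp only
        split_ifs <;> omega
    · rintro ⟨u, z, hu, hz, hd, hzx, -, huz⟩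
      have h1 : ∀ i, S i ≤ d i := fun i => by
        have := hu i
        have := hd i
        omega
      refine ⟨h1, fun i j _ _ => ⟨h1 i, h1 j⟩, fun i j hij hi hj => ?_⟩
      have hz1 : ∀ i, S i < d i → z i = 1 := fun i hi => by
        rcases hz i with h | h
        · have h4 := huz i
          have := hd i
          rw [h, mul_zero] at h4
          omega
        · exact h
      have h5 := hzx i j hij
      rw [hz1 i hi, hz1 j hj] at h5
      rcases h01 i j with h | h <;> omega
  exact key fun i => ∑ l ∈ Finset.univ.erase i, x i l
end

section
/- Let d : Fin n → ℕ. Call a triple (x, u, z) feasible if x is a graph on n nodes, the u_i ≥ 0 are integers, the z_i ∈ {0,1}, and: Σ_{j≠i} x_ij + u_i = d_i for all i; z_i + z_j − 1 ≤ x_ij for all i ≠ j; z_i ≤ u_i for all i; and u_i ≤ d_i · z_i for all i. Suppose (x, u, z) is feasible and maximizes Σ_i u_i among all feasible triples. Then x is pairwise stable for the payoffs Y_i(x) = −|η_i(x) − d_i|, and for every graph x' that is pairwise stable for these payoffs, Σ_i |η_i(x') − d_i| ≤ Σ_i |η_i(x) − d_i|; that is, x is a stable graph with the worst net payoff among all stable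 graphs. -/
/-- Feasibility of a triple `(x, u, z)` for the worst-stable-graph integer program. -/
def FeasibleTriple {n : ℕ} (d : Fin n → ℕ) (x : Fin n → Fin n → ℕ)
    (u z : Fin n → ℤ) : Prop :=
  IsGraph x ∧ (∀ i, 0 ≤ u i) ∧ (∀ i, z i = 0 ∨ z i = 1) ∧
  (∀ i, (∑ j ∈ Finset.univ.erase i, (x i j : ℤ)) + u i = (d i : ℤ)) ∧
  (∀ i j, i ≠ j → z i + z j - 1 ≤ (x i j : ℤ)) ∧
  (∀ i, z i ≤ u i) ∧ (∀ i, u i ≤ (d i : ℤ) * z i)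

lemma deg_addLink {n : ℕ} (x : Fin n → Fin n → ℕ) (i j : Fin n) (hij : i ≠ j)
    (h : x i j = 0) : deg (addLink x i j) i = deg x i + 1 := by
  unfold deg
  rw [← Finset.add_sum_erase _ _ (Finset.mem_univ j),
    ← Finset.add_sum_erase _ (x i) (Finset.mem_univ j), h]
  have : ∑ k ∈ Finset.univ.erase j, addLink x i j i k = ∑ k ∈ Finset.univ.erase j, x i k := by
    apply Finset.sum_congr rfl
    intro k hk
    have hk' := Finset.ne_of_mem_erase hk
    simp [addLink, hk', hij]
  rw [this]
  simp [addLink]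
  omega

lemma deg_removeLink {n : ℕ} (x : Fin n → Fin n → ℕ) (i j : Fin n) (hij : i ≠ j)
    (h : x i j = 1) : deg (removeLink x i j) i + 1 = deg x i := by
  unfold deg
  rw [← Finset.add_sum_erase _ _ (Finset.mem_univ j),
    ← Finset.add_sum_erase _ (x i) (Finset.mem_univ j), h]
  have : ∑ k ∈ Finset.univ.erase j, removeLink x i j i k
      = ∑ k ∈ Finset.univ.erase j, x i k := by
    apply Finset.sum_congr rfl
    intro k hk
    have hk' := Finset.ne_of_mem_erase hk
    simp [removeLink, hk', hij]
  rw [this]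
  simp [removeLink]
  omega

lemma addLink_comm {n : ℕ} (x : Fin n → Fin n → ℕ) (i j : Fin n) :
    addLink x i j = addLink x j i := by
  funext a b
  simp only [addLink, or_comm]

lemma deg_erase {n : ℕ} (x : Fin n → Fin n → ℕ) (hx : IsGraph x) (i : Fin n) :
    (∑ j ∈ Finset.univ.erase i, (x i j : ℤ)) = (deg x i : ℤ) := by
  unfold deg
  rw [← Finset.add_sum_erase _ (x i) (Finset.mem_univ i), hx.2.2 i]
  push_cast
  simp

lemma payoff_le (a b d : ℕ) :
    -|(a : ℝ) - (d : ℝ)| ≤ -|(b : ℝ) - (d : ℝ)| ↔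
      max ((b : ℤ) - d) (d - b) ≤ max ((a : ℤ) - d) (d - a) := by
  have h : |(b : ℤ) - (d : ℤ)| ≤ |(a : ℤ) - (d : ℤ)| ↔
      max ((b : ℤ) - d) (d - b) ≤ max ((a : ℤ) - d) (d - a) := by
    simp only [abs_eq_max_neg, neg_sub]
  rw [neg_le_neg_iff, ← h]
  exact_mod_cast Iff.rfl

lemma payoff_lt (a b d : ℕ) :
    -|(a : ℝ) - (d : ℝ)| < -|(b : ℝ) - (d : ℝ)| ↔
      max ((b : ℤ) - d) (d - b) < max ((a : ℤ) - d) (d - a) := by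
  have h : |(b : ℤ) - (d : ℤ)| < |(a : ℤ) - (d : ℤ)| ↔
      max ((b : ℤ) - d) (d - b) < max ((a : ℤ) - d) (d - a) := by
    simp only [abs_eq_max_neg, neg_sub]
  rw [neg_lt_neg_iff, ← h]
  exact_mod_cast Iff.rfl


theorem stmt9 {n : ℕ} (d : Fin n → ℕ) (x : Fin n → Fin n → ℕ) (u z : Fin n → ℤ)
    (hfeas : FeasibleTriple d x u z)
    (hopt : ∀ (x' : Fin n → Fin n → ℕ) (u' z' : Fin n → ℤ),
      FeasibleTriple d x' u' z' → ∑ i, u' i ≤ ∑ i, u i)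
    (Y : Fin n → (Fin n → Fin n → ℕ) → ℝ)
    (hY : ∀ i y, Y i y = -|(deg y i : ℝ) - (d i : ℝ)|) :
    PairwiseStable Y x ∧
      ∀ x' : Fin n → Fin n → ℕ, IsGraph x' → PairwiseStable Y x' →
        ∑ i, |(deg x' i : ℤ) - (d i : ℤ)| ≤ ∑ i, |(deg x i : ℤ) - (d i : ℤ)| := by
  simp only [PairwiseStable, hY, payoff_le, payoff_lt]
  obtain ⟨hx, hu0, hz, hdeg, hzz, hzu, hud⟩ := hfeas
  have hD : ∀ i, (deg x i : ℤ) + u i = d i := fun i => by rw [← deg_erase x hx i]; exact hdeg i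
  have hsum : ∑ i, |(deg x i : ℤ) - (d i : ℤ)| = ∑ i, u i := by
    apply Finset.sum_congr rfl
    intro i _
    have h1 := hD i
    have h2 := hu0 i
    rw [abs_of_nonpos] <;> omega
  refine ⟨⟨?_, ?_⟩, ?_⟩
  · intro i j hij h
    have h1 := deg_removeLink x i j hij h
    have h2 := hD i
    have h3 := hu0 i
    omega
  · intro i j hij h hlt
    rw [addLink_comm x i j, deg_addLink x j i hij.symm (by rw [hx.2.1]; exact h)]
    rw [deg_addLink x i j hij h] at hlt
    have h1 := hD i
    have h2 := hu0 i
    have h3 := hD j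
    have h4 := hu0 j
    have h5 := hzz i j hij
    have h6 := hud i
    have h7 := hud j
    rw [h] at h5
    rcases hz i with hi | hi <;> rcases hz j with hj | hj <;>
      simp only [hi, hj, mul_zero, mul_one] at h5 h6 h7 <;> omega
  · intro x' hx' ⟨hr, ha⟩
    have hle : ∀ i, deg x' i ≤ d i := by
      intro i
      by_contra hc
      have hne : deg x' i ≠ 0 := by omega
      obtain ⟨j, -, hj⟩ := Finset.exists_ne_zero_of_sum_ne_zero hne
      have hj1 : x' i j = 1 := (hx'.1 i j).resolve_left hj
      have hij : i ≠ j := by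
        rintro rfl
        exact hj (hx'.2.2 i)
      have h1 := hr i j hij hj1
      have h2 := deg_removeLink x' i j hij hj1
      omega
    have hlink : ∀ i j, i ≠ j → deg x' i < d i → deg x' j < d j → x' i j = 1 := by
      intro i j hij hi hj
      refine (hx'.1 i j).resolve_left fun h => ?_
      have h1 := ha i j hij h
      rw [deg_addLink x' i j hij h, addLink_comm x' i j,
        deg_addLink x' j i hij.symm (by rw [hx'.2.1]; exact h)] at h1
      omega
    rw [hsum]
    have key := hopt x' (fun i => (d i : ℤ) - deg x' i)
      (fun i => if deg x' i < d i then 1 else 0) ?_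
    · refine le_trans (le_of_eq ?_) key
      apply Finset.sum_congr rfl
      intro i _
      have h1 := hle i
      rw [abs_of_nonpos] <;> omega
    · refine ⟨hx', ?_, ?_, ?_, ?_, ?_, ?_⟩
      · intro i
        have h1 := hle i
        simp only
        omega
      · intro i
        simp only
        split_ifs <;> simp
      · intro i
        rw [deg_erase x' hx' i]
        simp
      · intro i j hij
        have h1 := hlink i j hij
        simp only
        split_ifs with h2 h3 h3
        · rw [h1 h2 h3]; simp
        all_goals omega
      · intro i
        have h1 := hle i
        simp only
        split_ifs <;> omega
      · intro i
        have h1 := hle i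
        simp only
        split_ifs <;> omega
end
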